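/- Let p = 2 and f ∈ C¹_p. Then lim_{h↓0} (I^Mean(h)f − μf)/h = φ*( ( ∫_X ‖ ∇f(y) − ∫_X ∇f dμ ‖² μ(dy) )^{1/2} ), where μf := ∫_X f dμ and φ* is the convex conjugate of φ. -/

import Mathlib

open MeasureTheory Filter Set
open scoped Topology ENNReal NNReal RealInnerProductSpace

noncomputable section

variable {X : Type*} [NormedAddCommGroup X] [InnerProductSpace ℝ X]
  [SecondCountableTopology X] [CompleteSpace X] [MeasurableSpace X] [BorelSpace X]

/-- `π` is a coupling of `μ` and `ν`. -/
def IsCoupling (μ ν : Measure X) (π : Measure (X × X)) : Prop :=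
  π.map Prod.fst = μ ∧ π.map Prod.snd = ν

/-- The `p`-Wasserstein distance between `μ` and `ν` (valued in `ℝ≥0∞`). -/
def Wp (p : ℝ) (μ ν : Measure X) : ℝ≥0∞ :=
  (⨅ π ∈ {π : Measure (X × X) | IsCoupling μ ν π},
    ∫⁻ q, (‖q.1 - q.2‖₊ : ℝ≥0∞) ^ p ∂π) ^ (1 / p)

/-- Borel probability measures with finite `p`-th moment. -/
def Pp (p : ℝ) : Set (Measure X) :=
  {ν | IsProbabilityMeasure ν ∧ ∫⁻ x, (‖x‖₊ : ℝ≥0∞) ^ p ∂ν < ⊤}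

/-- The rescaled penalty function `φ_h(v) = h·φ(v/h)`. -/
def phih (φ : ℝ → ℝ≥0∞) (h v : ℝ) : ℝ≥0∞ := ENNReal.ofReal h * φ (v / h)

/-- The risk functional `I(h) f`. -/
def Ifun (μ : Measure X) (φ : ℝ → ℝ≥0∞) (p h : ℝ) (f : X → ℝ) : EReal :=
  ⨆ ν ∈ Pp (X := X) p,
    ((∫ x, f x ∂ν : ℝ) : EReal) - ((phih φ h (Wp p μ ν).toReal : ℝ≥0∞) : EReal)

/-- The `L_p(μ; X)` norm of a vector field. -/
def lpnorm (μ : Measure X) (p : ℝ) (θ : X → X) : ℝ := (∫ y, ‖θ y‖ ^ p ∂μ) ^ (1 / p)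

/-- The parametric risk functional `I_Θ(h) f`, where `μ_θ` is the pushforward of `μ`
under `y ↦ y + θ(y)`. -/
def ITheta (μ : Measure X) (φ : ℝ → ℝ≥0∞) (p : ℝ) (Θ : Set (X → X)) (h : ℝ)
    (f : X → ℝ) : EReal :=
  ⨆ θ ∈ Θ, ((∫ x, f x ∂(μ.map fun y => y + θ y) : ℝ) : EReal)
    - ((phih φ h (lpnorm μ p θ) : ℝ≥0∞) : EReal)

/-- Membership in `Lip_p`. -/
def MemLipP (p : ℝ) (f : X → ℝ) : Prop :=
  ∃ L : ℝ, 0 ≤ L ∧ ∀ x₁ x₂ : X,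
    |f x₁ - f x₂| ≤ L * (1 + max ‖x₁‖ ‖x₂‖) ^ (p - 1) * ‖x₁ - x₂‖

/-- The local Lipschitz constant `|f|_Lip`. -/
def locLip (f : X → ℝ) (x : X) : ℝ :=
  limsup (fun h : ℝ =>
      sSup ((fun u : X => (f (x + h • u) - f x) / h) '' {u : X | ‖u‖ = 0 ∨ ‖u‖ = 1}))
    (𝓝[>] (0 : ℝ))

/-- `v` is a measurable direction of steepest ascent for `f`. -/
def SteepestAscent (f : X → ℝ) (v : X → X) : Prop :=
  Measurable v ∧ ∀ x : X, (‖v x‖ = 0 ∨ ‖v x‖ = 1) ∧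
    Tendsto (fun h : ℝ => (f (x + h • v x) - f x) / h) (𝓝[>] (0 : ℝ)) (𝓝 (locLip f x))

/-- The convex conjugate `φ*` of the penalty function. -/
def phiStar (φ : ℝ → ℝ≥0∞) (u : ℝ) : EReal :=
  ⨆ v ∈ Ici (0 : ℝ), ((u * v : ℝ) : EReal) - ((φ v : ℝ≥0∞) : EReal)

/-- Membership in `C¹_p`: continuously Fréchet differentiable with gradient growing
at most like `C(1+‖x‖)^{p-1}`. -/
def MemC1p (p : ℝ) (f : X → ℝ) : Prop :=
  ContDiff ℝ 1 f ∧ ∃ C : ℝ, 0 ≤ C ∧ ∀ x : X, ‖gradient f x‖ ≤ C * (1 + ‖x‖) ^ (p - 1)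

/-- Measures in `P_p` with the same (Bochner) barycenter as `μ`. -/
def PpMean (p : ℝ) (μ : Measure X) : Set (Measure X) :=
  {ν | ν ∈ Pp (X := X) p ∧ ∫ z, z ∂ν = ∫ y, y ∂μ}

/-- The mean-constrained risk functional `I^Mean(h) f`. -/
def IMean (μ : Measure X) (φ : ℝ → ℝ≥0∞) (p h : ℝ) (f : X → ℝ) : EReal :=
  ⨆ ν ∈ PpMean p μ,
    ((∫ x, f x ∂ν : ℝ) : EReal) - ((phih φ h (Wp p μ ν).toReal : ℝ≥0∞) : EReal)

set_option linter.unusedSectionVars false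

theorem mem_Pp_two_iff {ν : Measure X} :
    ν ∈ Pp (X := X) 2 ↔ IsProbabilityMeasure ν ∧ MemLp (fun x : X => x) 2 ν := by
  have key : eLpNorm (fun x : X => x) 2 ν < ⊤ ↔ ∫⁻ x, (‖x‖₊ : ℝ≥0∞) ^ (2 : ℝ) ∂ν < ⊤ := by
    rw [eLpNorm_lt_top_iff_lintegral_rpow_enorm_lt_top (by norm_num) (by norm_num)]
    simp [enorm_eq_nnnorm]
  constructor
  · rintro ⟨h1, h2⟩
    exact ⟨h1, continuous_id.aestronglyMeasurable, key.2 h2⟩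
  · rintro ⟨h1, h2⟩
    exact ⟨h1, key.1 h2.2⟩

theorem lintegral_rpow_two_eq_ofReal_sqrt {α : Type*} [MeasurableSpace α] {π : Measure α}
    {g : α → X} (hg : MemLp g 2 π) :
    (∫⁻ a, (‖g a‖₊ : ℝ≥0∞) ^ (2 : ℝ) ∂π) ^ (1 / (2 : ℝ))
      = ENNReal.ofReal (Real.sqrt (∫ a, ‖g a‖ ^ 2 ∂π)) := by
  have h1 := hg.eLpNorm_eq_integral_rpow_norm (by norm_num) (by norm_num)
  rw [eLpNorm_eq_lintegral_rpow_enorm_toReal (by norm_num) (by norm_num)] at h1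
  simp only [ENNReal.toReal_ofNat, enorm_eq_nnnorm, Real.rpow_ofNat] at h1
  rw [h1, Real.sqrt_eq_rpow, one_div]

theorem IsCoupling.measurePreserving_fst {μ ν : Measure X} {π : Measure (X × X)}
    (h : IsCoupling μ ν π) : MeasurePreserving Prod.fst π μ :=
  ⟨measurable_fst, h.1⟩

theorem IsCoupling.measurePreserving_snd {μ ν : Measure X} {π : Measure (X × X)}
    (h : IsCoupling μ ν π) : MeasurePreserving Prod.snd π ν :=
  ⟨measurable_snd, h.2⟩

theorem IsCoupling.memLp_sub {μ ν : Measure X} {π : Measure (X × X)}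
    (h : IsCoupling μ ν π) (hμ : μ ∈ Pp (X := X) 2) (hν : ν ∈ Pp (X := X) 2) :
    MemLp (fun q : X × X => q.1 - q.2) 2 π :=
  ((mem_Pp_two_iff.1 hμ).2.comp_measurePreserving h.measurePreserving_fst).sub
    ((mem_Pp_two_iff.1 hν).2.comp_measurePreserving h.measurePreserving_snd)

theorem Wp_eq_iInf {μ ν : Measure X} (hμ : μ ∈ Pp (X := X) 2) (hν : ν ∈ Pp (X := X) 2) :
    Wp 2 μ ν = ⨅ π ∈ {π : Measure (X × X) | IsCoupling μ ν π},
      ENNReal.ofReal (Real.sqrt (∫ q, ‖q.1 - q.2‖ ^ 2 ∂π)) := by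
  have e : ∀ A : ℝ≥0∞, A ^ (1 / (2 : ℝ)) = ENNReal.orderIsoRpow (1 / (2 : ℝ)) (by norm_num) A :=
    fun A => rfl
  rw [Wp, e]
  simp only [OrderIso.map_iInf]
  refine iInf_congr fun π => iInf_congr fun hπ => ?_
  rw [← e]
  exact lintegral_rpow_two_eq_ofReal_sqrt (IsCoupling.memLp_sub hπ hμ hν)

theorem toReal_Wp_le {μ ν : Measure X} {π : Measure (X × X)} (h : IsCoupling μ ν π)
    (hμ : μ ∈ Pp (X := X) 2) (hν : ν ∈ Pp (X := X) 2) :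
    (Wp 2 μ ν).toReal ≤ Real.sqrt (∫ q, ‖q.1 - q.2‖ ^ 2 ∂π) := by
  rw [Wp_eq_iInf hμ hν]
  exact ENNReal.toReal_le_of_le_ofReal (Real.sqrt_nonneg _) (iInf₂_le π h)

theorem exists_isCoupling_lt {μ ν : Measure X}
    (hμ : μ ∈ Pp (X := X) 2) (hν : ν ∈ Pp (X := X) 2) {δ : ℝ} (hδ : 0 < δ) :
    ∃ π, IsCoupling μ ν π ∧ Real.sqrt (∫ q, ‖q.1 - q.2‖ ^ 2 ∂π) < (Wp 2 μ ν).toReal + δ := by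
  have := hμ.1
  have := hν.1
  have hprod : IsCoupling μ ν (μ.prod ν) := ⟨by simp, by simp⟩
  have hfin : Wp 2 μ ν ≠ ⊤ := by
    rw [Wp_eq_iInf hμ hν]
    exact ne_top_of_le_ne_top ENNReal.ofReal_ne_top (iInf₂_le _ hprod)
  have hlt : Wp 2 μ ν < ENNReal.ofReal ((Wp 2 μ ν).toReal + δ) := by
    rw [ENNReal.lt_ofReal_iff_toReal_lt hfin]
    linarith
  nth_rewrite 1 [Wp_eq_iInf hμ hν] at hlt
  obtain ⟨π, hπ⟩ := iInf_lt_iff.1 hlt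
  obtain ⟨hc, hπ⟩ := iInf_lt_iff.1 hπ
  exact ⟨π, hc, (ENNReal.ofReal_lt_ofReal_iff (by positivity)).1 hπ⟩

theorem abs_sub_sub_fderiv_le {f : X → ℝ} (hf : Differentiable ℝ f) {y k : X} {c : ℝ}
    (hc : ∀ j : X, ‖j‖ ≤ ‖k‖ → ‖fderiv ℝ f (y + j) - fderiv ℝ f y‖ ≤ c) :
    |f (y + k) - f y - fderiv ℝ f y k| ≤ c * ‖k‖ := by
  have := (convex_closedBall y ‖k‖).norm_image_sub_le_of_norm_fderiv_le'
    (𝕜 := ℝ) (f := f) (C := c) (x := y) (y := y + k) (φ := fderiv ℝ f y)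
    (fun x _ => hf x) (fun x hx => by
      have := hc (x - y) (by simpa [dist_eq_norm] using hx)
      simpa using this) (by simp) (by simp)
  simpa using this

theorem norm_fderiv_eq_norm_gradient (f : X → ℝ) (x : X) : ‖fderiv ℝ f x‖ = ‖gradient f x‖ := by
  simp [gradient]

theorem inner_gradient_eq (f : X → ℝ) (x k : X) : ⟪gradient f x, k⟫ = fderiv ℝ f x k := by
  simp [gradient, InnerProductSpace.toDual_symm_apply]

theorem MemC1p.exists_bound {f : X → ℝ} (hf : MemC1p 2 f) :
    ∃ C : ℝ, 0 ≤ C ∧ ∀ x : X, ‖fderiv ℝ f x‖ ≤ C * (1 + ‖x‖) := by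
  obtain ⟨-, C, hC, h⟩ := hf
  refine ⟨C, hC, fun x => ?_⟩
  have := h x
  norm_num at this
  rwa [norm_fderiv_eq_norm_gradient]

theorem continuous_gradient {f : X → ℝ} (hf : ContDiff ℝ 1 f) : Continuous (gradient f) :=
  (InnerProductSpace.toDual ℝ X).symm.continuous.comp (hf.continuous_fderiv (by norm_num))

/-- Growth of the first-order Taylor remainder of a function with linearly growing derivative. -/
theorem abs_sub_sub_fderiv_le_of_bound {f : X → ℝ} (hf : Differentiable ℝ f) {C : ℝ} (hC : 0 ≤ C)
    (hb : ∀ x : X, ‖fderiv ℝ f x‖ ≤ C * (1 + ‖x‖)) (y k : X) :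
    |f (y + k) - f y - fderiv ℝ f y k| ≤ 2 * C * (1 + ‖y‖ + ‖k‖) * ‖k‖ := by
  refine abs_sub_sub_fderiv_le hf fun j hj => ?_
  have h1 := hb (y + j)
  have h2 := hb y
  have h3 := norm_add_le y j
  have h4 := norm_sub_le (fderiv ℝ f (y + j)) (fderiv ℝ f y)
  have h5 : C * (1 + ‖y + j‖) ≤ C * (1 + ‖y‖ + ‖k‖) := mul_le_mul_of_nonneg_left (by linarith) hC
  have h6 : C * (1 + ‖y‖) ≤ C * (1 + ‖y‖ + ‖k‖) :=
    mul_le_mul_of_nonneg_left (by linarith [norm_nonneg k]) hC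
  linarith

theorem abs_sub_le_of_bound {f : X → ℝ} (hf : Differentiable ℝ f) {C : ℝ} (hC : 0 ≤ C)
    (hb : ∀ x : X, ‖fderiv ℝ f x‖ ≤ C * (1 + ‖x‖)) (y k : X) :
    |f (y + k) - f y| ≤ 3 * C * (1 + ‖y‖ + ‖k‖) * ‖k‖ := by
  have h1 := abs_sub_sub_fderiv_le_of_bound hf hC hb y k
  have h2 := (fderiv ℝ f y).le_opNorm k
  have h3 : ‖fderiv ℝ f y‖ * ‖k‖ ≤ C * (1 + ‖y‖ + ‖k‖) * ‖k‖ := by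
    refine mul_le_mul_of_nonneg_right ((hb y).trans ?_) (norm_nonneg _)
    exact mul_le_mul_of_nonneg_left (by linarith [norm_nonneg k]) hC
  rw [Real.norm_eq_abs] at h2
  have h4 := abs_add_le (f (y + k) - f y - fderiv ℝ f y k) (fderiv ℝ f y k)
  rw [sub_add_cancel] at h4
  linarith

theorem integrable_of_bound {f : X → ℝ} (hf : ContDiff ℝ 1 f) {C : ℝ} (hC : 0 ≤ C)
    (hb : ∀ x : X, ‖fderiv ℝ f x‖ ≤ C * (1 + ‖x‖)) {ν : Measure X} (hν : ν ∈ Pp (X := X) 2) :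
    Integrable f ν := by
  obtain ⟨hP, hL⟩ := mem_Pp_two_iff.1 hν
  have h1 : Integrable (fun x : X => ‖x‖) ν := (hL.integrable (by norm_num)).norm
  have h2 : Integrable (fun x : X => ‖x‖ ^ 2) ν := hL.integrable_norm_pow (p := 2) (by norm_num)
  refine Integrable.mono' (g := fun x => |f 0| + 3 * C * (‖x‖ + ‖x‖ ^ 2))
    ((integrable_const _).add ((h1.add h2).const_mul _)) hf.continuous.aestronglyMeasurable
    (Eventually.of_forall fun x => ?_)
  have h3 := abs_sub_le_of_bound (hf.differentiable (by norm_num)) hC hb 0 x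
  simp only [zero_add, norm_zero, add_zero] at h3
  have h4 := abs_add_le (f x - f 0) (f 0)
  rw [sub_add_cancel] at h4
  rw [Real.norm_eq_abs]
  nlinarith

theorem memLp_gradient {f : X → ℝ} (hf : ContDiff ℝ 1 f) {C : ℝ}
    (hb : ∀ x : X, ‖fderiv ℝ f x‖ ≤ C * (1 + ‖x‖)) {ν : Measure X} (hν : ν ∈ Pp (X := X) 2) :
    MemLp (gradient f) 2 ν := by
  obtain ⟨hP, hL⟩ := mem_Pp_two_iff.1 hν
  have h1 : MemLp (fun x : X => 1 + ‖x‖) 2 ν := (memLp_const (1 : ℝ)).add hL.norm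
  refine MemLp.of_le_mul (c := C) h1 (continuous_gradient hf).aestronglyMeasurable
    (Eventually.of_forall fun x => ?_)
  rw [← norm_fderiv_eq_norm_gradient, Real.norm_of_nonneg (by positivity)]
  exact hb x

theorem IsCoupling.integrable_mul_norm {μ ν : Measure X} {π : Measure (X × X)}
    (h : IsCoupling μ ν π) (hμ : μ ∈ Pp (X := X) 2) (hν : ν ∈ Pp (X := X) 2)
    {A : X → ℝ} (hA : MemLp A 2 μ) :
    Integrable (fun q : X × X => A q.1 * ‖q.1 - q.2‖) π :=
  (hA.comp_measurePreserving h.measurePreserving_fst).integrable_mul (h.memLp_sub hμ hν).norm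

theorem IsCoupling.integral_mul_norm_le {μ ν : Measure X} {π : Measure (X × X)}
    (h : IsCoupling μ ν π) (hμ : μ ∈ Pp (X := X) 2) (hν : ν ∈ Pp (X := X) 2)
    {A : X → ℝ} (hA : MemLp A 2 μ) (hA0 : ∀ y, 0 ≤ A y) :
    ∫ q, A q.1 * ‖q.1 - q.2‖ ∂π
      ≤ Real.sqrt (∫ y, A y ^ 2 ∂μ) * Real.sqrt (∫ q, ‖q.1 - q.2‖ ^ 2 ∂π) := by
  have hA' : MemLp (fun q : X × X => A q.1) 2 π :=
    hA.comp_measurePreserving h.measurePreserving_fst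
  have h1 := integral_mul_le_Lp_mul_Lq_of_nonneg (μ := π) Real.HolderConjugate.two_two
    (f := fun q : X × X => A q.1) (g := fun q : X × X => ‖q.1 - q.2‖)
    (Eventually.of_forall fun q => hA0 q.1) (Eventually.of_forall fun q => norm_nonneg _)
    (by simpa using hA') (by simpa using (h.memLp_sub hμ hν).norm)
  have h2 : ∫ q, A q.1 ^ 2 ∂π = ∫ y, A y ^ 2 ∂μ := by
    conv_rhs => rw [← h.1]
    rw [integral_map measurable_fst.aemeasurable]
    rw [h.1]
    exact (hA.aestronglyMeasurable.aemeasurable.pow_const 2).aestronglyMeasurable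
  simp only [Real.rpow_ofNat, ← Real.sqrt_eq_rpow, h2] at h1
  exact h1

/-- Points outside a set of small weighted mass have a uniform modulus of continuity of the
derivative. -/
theorem exists_measurableSet_uniform_modulus {f : X → ℝ} (hf : ContDiff ℝ 1 f) {μ : Measure X}
    (hμ : μ ∈ Pp (X := X) 2) {ε : ℝ} (hε : 0 < ε) :
    ∃ B : Set X, ∃ n : ℕ, MeasurableSet B ∧ (∀ y ∈ B, ‖y‖ ≤ n) ∧
      (∀ y ∈ B, ∀ k : X, ‖k‖ ≤ 1 / ((n : ℝ) + 1) →
        ‖fderiv ℝ f (y + k) - fderiv ℝ f y‖ ≤ ε) ∧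
      Real.sqrt (∫ y, (Bᶜ.indicator (fun x => 1 + ‖x‖) y) ^ 2 ∂μ) ≤ ε := by
  obtain ⟨hP, hL⟩ := mem_Pp_two_iff.1 hμ
  have hc : Continuous (fderiv ℝ f) := hf.continuous_fderiv (by norm_num)
  let B : ℕ → Set X := fun n => {y | ‖y‖ ≤ n} ∩ {y | ∀ k : X, ‖k‖ ≤ 1 / ((n : ℝ) + 1) →
    ‖fderiv ℝ f (y + k) - fderiv ℝ f y‖ ≤ ε}
  have hB : ∀ n, MeasurableSet (B n) := fun n => by
    refine (IsClosed.inter (isClosed_le continuous_norm continuous_const) ?_).measurableSet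
    simp only [ofPred_forall]
    exact isClosed_iInter fun k => isClosed_iInter fun _ =>
      isClosed_le (by fun_prop) continuous_const
  have hev : ∀ y, ∀ᶠ n : ℕ in atTop, y ∈ B n := fun y => by
    obtain ⟨δ, hδ, hy⟩ := Metric.continuousAt_iff.1 (hc.continuousAt (x := y)) ε hε
    have h1 : ∀ᶠ n : ℕ in atTop, ‖y‖ ≤ n := tendsto_natCast_atTop_atTop.eventually_ge_atTop _
    have h2 : ∀ᶠ n : ℕ in atTop, 1 / ((n : ℝ) + 1) < δ :=
      tendsto_one_div_add_atTop_nhds_zero_nat.eventually_lt_const hδ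
    filter_upwards [h1, h2] with n h1 h2
    refine ⟨h1, fun k hk => ?_⟩
    have := hy (x := y + k) (by simpa using hk.trans_lt h2)
    rw [dist_eq_norm] at this
    exact this.le
  have hint : Integrable (fun x : X => (1 + ‖x‖) ^ 2) μ :=
    ((memLp_const (1 : ℝ)).add hL.norm).integrable_sq
  have hlim : Tendsto (fun n => ∫ y, ((B n)ᶜ.indicator (fun x => 1 + ‖x‖) y) ^ 2 ∂μ) atTop
      (𝓝 (∫ _, (0 : ℝ) ∂μ)) := by
    refine tendsto_integral_of_dominated_convergence _ (fun n => ?_) hint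
      (fun n => Eventually.of_forall fun y => ?_) (Eventually.of_forall fun y => ?_)
    · have : Measurable ((B n)ᶜ.indicator (fun x : X => 1 + ‖x‖)) :=
        Measurable.indicator (by fun_prop) (hB n).compl
      exact (this.pow_const 2).aestronglyMeasurable
    · rw [Real.norm_of_nonneg (sq_nonneg _)]
      by_cases h : y ∈ (B n)ᶜ
      · simp [h]
      · simp only [h, not_false_eq_true, indicator_of_notMem]
        rw [zero_pow two_ne_zero]
        positivity
    · refine tendsto_const_nhds.congr' ?_
      filter_upwards [hev y] with n hn
      simp [hn]
  rw [integral_zero] at hlim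
  have hlim' := (Real.continuous_sqrt.tendsto 0).comp hlim
  rw [Real.sqrt_zero] at hlim'
  obtain ⟨n, hn⟩ := (hlim'.eventually_le_const hε).exists
  exact ⟨B n, n, hB n, fun y hy => hy.1, fun y hy => hy.2, hn⟩

theorem exists_abs_remainder_le {f : X → ℝ} (hf : MemC1p 2 f) {μ : Measure X}
    (hμ : μ ∈ Pp (X := X) 2) {ε : ℝ} (hε : 0 < ε) :
    ∃ A : X → ℝ, ∃ K : ℝ, MemLp A 2 μ ∧ (∀ y, 0 ≤ A y) ∧ 0 ≤ K ∧
      Real.sqrt (∫ y, A y ^ 2 ∂μ) ≤ ε ∧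
      ∀ y k : X, |f (y + k) - f y - fderiv ℝ f y k| ≤ (ε + A y) * ‖k‖ + K * ‖k‖ ^ 2 := by
  obtain ⟨hP, hL⟩ := mem_Pp_two_iff.1 hμ
  obtain ⟨C, hC, hb⟩ := hf.exists_bound
  have hd := hf.1.differentiable (by norm_num)
  have hC' : 0 < 2 * C + 1 := by positivity
  obtain ⟨B, n, hB, hBn, hBε, hBi⟩ := exists_measurableSet_uniform_modulus hf.1 hμ
    (ε := min ε (ε / (2 * C + 1))) (lt_min hε (div_pos hε hC'))
  refine ⟨fun y => (2 * C + 1) * Bᶜ.indicator (fun x => 1 + ‖x‖) y,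
    2 * C * (1 + (1 + n) * (n + 1)), ?_, ?_, by positivity, ?_, ?_⟩
  · exact (((memLp_const (1 : ℝ)).add hL.norm).indicator hB.compl).const_mul _
  · exact fun y => mul_nonneg hC'.le (indicator_nonneg (fun x _ => by positivity) y)
  · simp only [mul_pow]
    rw [integral_const_mul, Real.sqrt_mul (by positivity), Real.sqrt_sq hC'.le]
    have := hBi.trans (min_le_right _ _)
    rwa [le_div_iff₀' hC'] at this
  · intro y k
    beta_reduce
    have hr := abs_sub_sub_fderiv_le_of_bound hd hC hb y k
    have hk := norm_nonneg k
    have hkk : 0 ≤ 2 * C * ‖k‖ ^ 2 * ((1 + n) * (n + 1)) := by positivity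
    by_cases hy : y ∈ B
    · have e : Bᶜ.indicator (fun x : X => 1 + ‖x‖) y = 0 := by simp [hy]
      rw [e, mul_zero, add_zero]
      by_cases hkn : ‖k‖ ≤ 1 / ((n : ℝ) + 1)
      · have := abs_sub_sub_fderiv_le hd (y := y) (k := k) (c := ε) fun j hj =>
          (hBε y hy j (hj.trans hkn)).trans (min_le_left _ _)
        refine this.trans (le_add_of_nonneg_right (by positivity))
      · rw [not_le, div_lt_iff₀ (by positivity)] at hkn
        have h1 : 1 + ‖y‖ ≤ (1 + n) * (‖k‖ * (n + 1)) := by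
          have := hBn y hy
          nlinarith
        have h2 : 2 * C * (1 + ‖y‖ + ‖k‖) * ‖k‖
            ≤ 2 * C * ((1 + n) * (‖k‖ * (n + 1)) + ‖k‖) * ‖k‖ := by gcongr
        have h3 : 0 ≤ ε * ‖k‖ := by positivity
        refine (hr.trans h2).trans ?_
        linarith
    · have e : Bᶜ.indicator (fun x : X => 1 + ‖x‖) y = 1 + ‖y‖ := by simp [hy]
      rw [e]
      have h3 : 0 ≤ ε * ‖k‖ := by positivity
      have h4 : 0 ≤ (1 + ‖y‖) * ‖k‖ := by positivity
      refine hr.trans ?_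
      linarith

theorem IsCoupling.integral_sub_le {μ ν : Measure X} {π : Measure (X × X)}
    (h : IsCoupling μ ν π) (hμ : μ ∈ Pp (X := X) 2) (hν : ν ∈ PpMean (X := X) 2 μ)
    {f : X → ℝ} (hf : MemC1p 2 f) {ε K : ℝ} {A : X → ℝ} (hA : MemLp A 2 μ) (hA0 : ∀ y, 0 ≤ A y)
    (hAε : Real.sqrt (∫ y, A y ^ 2 ∂μ) ≤ ε)
    (hK : ∀ y k : X, |f (y + k) - f y - fderiv ℝ f y k| ≤ (ε + A y) * ‖k‖ + K * ‖k‖ ^ 2) :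
    ∫ x, f x ∂ν - ∫ x, f x ∂μ
      ≤ (Real.sqrt (∫ y, ‖gradient f y - ∫ z, gradient f z ∂μ‖ ^ 2 ∂μ) + 2 * ε)
          * Real.sqrt (∫ q, ‖q.1 - q.2‖ ^ 2 ∂π) + K * Real.sqrt (∫ q, ‖q.1 - q.2‖ ^ 2 ∂π) ^ 2 := by
  obtain ⟨hP, hL⟩ := mem_Pp_two_iff.1 hμ
  obtain ⟨hPν, hLν⟩ := mem_Pp_two_iff.1 hν.1
  obtain ⟨C, hC, hb⟩ := hf.exists_bound
  set m := ∫ z, gradient f z ∂μ with hm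
  have hg : MemLp (fun y => ‖gradient f y - m‖) 2 μ :=
    ((memLp_gradient hf.1 hb hμ).sub (memLp_const m)).norm
  have h1 := h.measurePreserving_fst
  have h2 := h.measurePreserving_snd
  have i1 : Integrable (fun q : X × X => f q.1) π :=
    h1.integrable_comp_of_integrable (integrable_of_bound hf.1 hC hb hμ)
  have i2 : Integrable (fun q : X × X => f q.2) π :=
    h2.integrable_comp_of_integrable (integrable_of_bound hf.1 hC hb hν.1)
  have j1 : Integrable (fun q : X × X => q.1) π :=
    h1.integrable_comp_of_integrable (hL.integrable (by norm_num))
  have j2 : Integrable (fun q : X × X => q.2) π :=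
    h2.integrable_comp_of_integrable (hLν.integrable (by norm_num))
  have e1 : ∫ q, f q.1 ∂π = ∫ x, f x ∂μ := by
    rw [← h.1, integral_map measurable_fst.aemeasurable hf.1.continuous.aestronglyMeasurable]
  have e2 : ∫ q, f q.2 ∂π = ∫ x, f x ∂ν := by
    rw [← h.2, integral_map measurable_snd.aemeasurable hf.1.continuous.aestronglyMeasurable]
  have e3 : ∫ q : X × X, q.1 ∂π = ∫ x, x ∂μ := by
    rw [← h.1, integral_map measurable_fst.aemeasurable continuous_id'.aestronglyMeasurable]
  have e4 : ∫ q : X × X, q.2 ∂π = ∫ x, x ∂ν := by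
    rw [← h.2, integral_map measurable_snd.aemeasurable continuous_id'.aestronglyMeasurable]
  have j3 : Integrable (fun q : X × X => q.2 - q.1) π := j2.sub j1
  have j4 : Integrable (fun q : X × X => ⟪m, q.2 - q.1⟫) π := j3.const_inner m
  have i3 : Integrable (fun q : X × X => f q.2 - f q.1) π := i2.sub i1
  have e5 : ∫ q : X × X, ⟪m, q.2 - q.1⟫ ∂π = 0 := by
    rw [integral_inner j3, integral_sub j2 j1, e3, e4, hν.2, sub_self, inner_zero_right]
  have e6 : ∫ x, f x ∂ν - ∫ x, f x ∂μ = ∫ q : X × X, (f q.2 - f q.1 - ⟪m, q.2 - q.1⟫) ∂π := by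
    rw [integral_sub i3 j4, integral_sub i2 i1, e1, e2, e5,
      sub_zero]
  have hsq : Integrable (fun q : X × X => ‖q.1 - q.2‖ ^ 2) π :=
    (h.memLp_sub hμ hν.1).integrable_norm_pow (p := 2) (by norm_num)
  have hε : MemLp (fun _ : X => ε) 2 μ := memLp_const ε
  have hε0 : 0 ≤ ε := (Real.sqrt_nonneg _).trans hAε
  have k1 := h.integrable_mul_norm hμ hν.1 hg
  have k2 := h.integrable_mul_norm hμ hν.1 hε
  have k3 := h.integrable_mul_norm hμ hν.1 hA
  have k4 : Integrable (fun q : X × X => ‖gradient f q.1 - m‖ * ‖q.1 - q.2‖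
      + ε * ‖q.1 - q.2‖) π := k1.add k2
  have k5 : Integrable (fun q : X × X => ‖gradient f q.1 - m‖ * ‖q.1 - q.2‖
      + ε * ‖q.1 - q.2‖ + A q.1 * ‖q.1 - q.2‖) π := k4.add k3
  have k6 : Integrable (fun q : X × X => ‖gradient f q.1 - m‖ * ‖q.1 - q.2‖
      + ε * ‖q.1 - q.2‖ + A q.1 * ‖q.1 - q.2‖ + K * ‖q.1 - q.2‖ ^ 2) π :=
    k5.add (hsq.const_mul K)
  have l1 := h.integral_mul_norm_le hμ hν.1 hg (fun y => norm_nonneg _)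
  have l2 := h.integral_mul_norm_le hμ hν.1 hε (fun y => hε0)
  have l3 := h.integral_mul_norm_le hμ hν.1 hA hA0
  have hpt : ∀ q : X × X, f q.2 - f q.1 - ⟪m, q.2 - q.1⟫ ≤
      ‖gradient f q.1 - m‖ * ‖q.1 - q.2‖ + ε * ‖q.1 - q.2‖ + A q.1 * ‖q.1 - q.2‖
        + K * ‖q.1 - q.2‖ ^ 2 := fun q => by
    have a1 := le_of_abs_le (hK q.1 (q.2 - q.1))
    have a2 := real_inner_le_norm (gradient f q.1 - m) (q.2 - q.1)
    rw [inner_sub_left, inner_gradient_eq] at a2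
    rw [add_sub_cancel] at a1
    rw [norm_sub_rev q.1 q.2]
    linarith
  rw [e6]
  refine (integral_mono (i3.sub j4) k6 hpt).trans ?_
  rw [integral_add k5 (hsq.const_mul K), integral_add k4 k3,
    integral_add k1 k2, integral_const_mul K]
  rw [Real.sq_sqrt (integral_nonneg fun q => by positivity)]
  have l4 : Real.sqrt (∫ _, ε ^ 2 ∂μ) = ε := by simp [Real.sqrt_sq hε0]
  rw [l4] at l2
  have l5 := mul_le_mul_of_nonneg_right hAε (Real.sqrt_nonneg (∫ q, ‖q.1 - q.2‖ ^ 2 ∂π))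
  linarith

/-- First-order upper bound for the variation of `∫ f` among measures with fixed barycenter. -/
theorem exists_integral_sub_le_Wp {μ : Measure X} (hμ : μ ∈ Pp (X := X) 2) {f : X → ℝ}
    (hf : MemC1p 2 f) {ε : ℝ} (hε : 0 < ε) :
    ∃ K : ℝ, 0 ≤ K ∧ ∀ ν ∈ PpMean (X := X) 2 μ,
      ∫ x, f x ∂ν - ∫ x, f x ∂μ
        ≤ (Real.sqrt (∫ y, ‖gradient f y - ∫ z, gradient f z ∂μ‖ ^ 2 ∂μ) + ε)
          * (Wp 2 μ ν).toReal + K * (Wp 2 μ ν).toReal ^ 2 := by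
  obtain ⟨A, K, hA, hA0, hK0, hAε, hK⟩ := exists_abs_remainder_le hf hμ (half_pos hε)
  refine ⟨K, hK0, fun ν hν => ?_⟩
  set u := Real.sqrt (∫ y, ‖gradient f y - ∫ z, gradient f z ∂μ‖ ^ 2 ∂μ) with hu
  set W := (Wp 2 μ ν).toReal
  have hu0 : 0 ≤ u := Real.sqrt_nonneg _
  have hcont : Continuous fun δ : ℝ => (u + ε) * (W + δ) + K * (W + δ) ^ 2 := by fun_prop
  have hlim := (hcont.tendsto 0).mono_left (nhdsWithin_le_nhds (s := Ioi 0))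
  rw [add_zero] at hlim
  refine ge_of_tendsto hlim ?_
  filter_upwards [self_mem_nhdsWithin] with δ hδ
  obtain ⟨π, hπ, hlt⟩ := exists_isCoupling_lt hμ hν.1 hδ
  have := hπ.integral_sub_le hμ hν hf hA hA0 hAε hK
  rw [← hu, mul_div_cancel₀ _ two_ne_zero] at this
  refine this.trans ?_
  gcongr

theorem isCoupling_map_add {μ : Measure X} {η : X → X} (hη : Measurable η) :
    IsCoupling μ (μ.map fun y => y + η y) (μ.map fun y => (y, y + η y)) := by
  have hm : Measurable fun y => (y, y + η y) := by fun_prop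
  constructor
  · rw [Measure.map_map measurable_fst hm]
    exact Measure.map_id
  · rw [Measure.map_map measurable_snd hm]
    rfl

theorem map_add_mem_Pp {μ : Measure X} (hμ : μ ∈ Pp (X := X) 2) {η : X → X} (hη : Measurable η)
    (hη2 : MemLp η 2 μ) : (μ.map fun y => y + η y) ∈ Pp (X := X) 2 := by
  obtain ⟨hP, hL⟩ := mem_Pp_two_iff.1 hμ
  have hm : Measurable fun y => y + η y := by fun_prop
  refine mem_Pp_two_iff.2 ⟨Measure.isProbabilityMeasure_map hm.aemeasurable, ?_⟩
  rw [memLp_map_measure_iff continuous_id'.aestronglyMeasurable hm.aemeasurable]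
  exact hL.add hη2

theorem map_add_mem_PpMean {μ : Measure X} (hμ : μ ∈ Pp (X := X) 2) {η : X → X}
    (hη : Measurable η) (hη2 : MemLp η 2 μ) (hη0 : ∫ y, η y ∂μ = 0) :
    (μ.map fun y => y + η y) ∈ PpMean (X := X) 2 μ := by
  obtain ⟨hP, hL⟩ := mem_Pp_two_iff.1 hμ
  refine ⟨map_add_mem_Pp hμ hη hη2, ?_⟩
  have hm : Measurable fun y => y + η y := by fun_prop
  rw [integral_map hm.aemeasurable continuous_id'.aestronglyMeasurable,
    integral_add (hL.integrable (by norm_num)) (hη2.integrable (by norm_num)), hη0, add_zero]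

theorem toReal_Wp_map_add_le {μ : Measure X} (hμ : μ ∈ Pp (X := X) 2) {η : X → X}
    (hη : Measurable η) (hη2 : MemLp η 2 μ) :
    (Wp 2 μ (μ.map fun y => y + η y)).toReal ≤ Real.sqrt (∫ y, ‖η y‖ ^ 2 ∂μ) := by
  refine (toReal_Wp_le (isCoupling_map_add hη) hμ (map_add_mem_Pp hμ hη hη2)).trans_eq ?_
  have hm : Measurable fun y => (y, y + η y) := by fun_prop
  have hc : Continuous fun q : X × X => ‖q.1 - q.2‖ ^ 2 := by fun_prop
  rw [integral_map hm.aemeasurable hc.aestronglyMeasurable]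
  simp

theorem tendsto_integral_map_sub_div {μ : Measure X} (hμ : μ ∈ Pp (X := X) 2) {f : X → ℝ}
    (hf : MemC1p 2 f) {θ : X → X} (hθ : Measurable θ) (hθ2 : MemLp θ 2 μ) :
    Tendsto (fun h : ℝ => h⁻¹ * (∫ x, f x ∂(μ.map fun y => y + h • θ y) - ∫ x, f x ∂μ))
      (𝓝[>] 0) (𝓝 (∫ y, ⟪gradient f y, θ y⟫ ∂μ)) := by
  obtain ⟨hP, hL⟩ := mem_Pp_two_iff.1 hμ
  obtain ⟨C, hC, hb⟩ := hf.exists_bound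
  have hd := hf.1.differentiable (by norm_num)
  have hm : ∀ h : ℝ, Measurable fun y => y + h • θ y := fun h => by fun_prop
  have hi : ∀ h : ℝ, Integrable (fun y => f (y + h • θ y)) μ := fun h =>
    (integrable_map_measure hf.1.continuous.aestronglyMeasurable (hm h).aemeasurable).1
      (integrable_of_bound hf.1 hC hb (map_add_mem_Pp hμ (hθ.const_smul h) (hθ2.const_smul h)))
  have he : ∀ h : ℝ, h⁻¹ * (∫ x, f x ∂(μ.map fun y => y + h • θ y) - ∫ x, f x ∂μ)
      = ∫ y, h⁻¹ * (f (y + h • θ y) - f y) ∂μ := fun h => by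
    rw [integral_map (hm h).aemeasurable hf.1.continuous.aestronglyMeasurable,
      ← integral_sub (hi h) (integrable_of_bound hf.1 hC hb hμ), integral_const_mul]
  simp only [he]
  refine tendsto_integral_filter_of_dominated_convergence
    (fun y => 3 * C * ((1 + ‖y‖ + ‖θ y‖) * ‖θ y‖))
    (Eventually.of_forall fun h =>
      (((hi h).sub (integrable_of_bound hf.1 hC hb hμ)).const_mul _).aestronglyMeasurable)
    ?_ ?_ ?_
  · have h01 : ∀ᶠ h : ℝ in 𝓝[>] 0, h ∈ Ioo (0 : ℝ) 1 := Ioo_mem_nhdsGT one_pos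
    filter_upwards [h01] with h hh
    refine Eventually.of_forall fun y => ?_
    have h1 := abs_sub_le_of_bound hd hC hb y (h • θ y)
    have h2 : ‖h • θ y‖ ≤ ‖θ y‖ := by
      rw [norm_smul, Real.norm_of_nonneg hh.1.le]
      exact mul_le_of_le_one_left (norm_nonneg _) hh.2.le
    have h3 : 3 * C * (1 + ‖y‖ + ‖h • θ y‖) * ‖h • θ y‖
        ≤ 3 * C * (1 + ‖y‖ + ‖θ y‖) * (h * ‖θ y‖) := by
      have : ‖h • θ y‖ = h * ‖θ y‖ := by rw [norm_smul, Real.norm_of_nonneg hh.1.le]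
      rw [← this]
      gcongr
    rw [norm_mul, norm_inv, Real.norm_of_nonneg hh.1.le, Real.norm_eq_abs,
      inv_mul_le_iff₀ hh.1]
    linarith
  · exact ((((memLp_const (1 : ℝ)).add hL.norm).add hθ2.norm).integrable_mul hθ2.norm).const_mul _
  · refine Eventually.of_forall fun y => ?_
    rw [inner_gradient_eq]
    have hl : HasDerivAt (fun h : ℝ => f (y + h • θ y)) (fderiv ℝ f y (θ y)) 0 := by
      have h1 : HasDerivAt (fun h : ℝ => y + h • θ y) (θ y) 0 := by
        simpa using ((hasDerivAt_id (0 : ℝ)).smul_const (θ y)).const_add y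
      have h2 : HasFDerivAt f (fderiv ℝ f y) (y + (0 : ℝ) • θ y) := by
        simpa using (hd y).hasFDerivAt
      exact h2.comp_hasDerivAt 0 h1
    simpa using hl.tendsto_slope_zero_right

/-- The centred gradient, scaled to have `L²` norm at most `v`, realizes the slope `u * v`. -/
theorem exists_field_of_gradient {μ : Measure X} (hμ : μ ∈ Pp (X := X) 2) {f : X → ℝ}
    (hf : MemC1p 2 f) {v : ℝ} (hv : 0 ≤ v) :
    ∃ θ : X → X, Measurable θ ∧ MemLp θ 2 μ ∧ ∫ y, θ y ∂μ = 0 ∧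
      Real.sqrt (∫ y, ‖θ y‖ ^ 2 ∂μ) ≤ v ∧
      ∫ y, ⟪gradient f y, θ y⟫ ∂μ
        = Real.sqrt (∫ y, ‖gradient f y - ∫ z, gradient f z ∂μ‖ ^ 2 ∂μ) * v := by
  obtain ⟨hP, hL⟩ := mem_Pp_two_iff.1 hμ
  obtain ⟨C, hC, hb⟩ := hf.exists_bound
  have hG := memLp_gradient hf.1 hb hμ
  set m := ∫ z, gradient f z ∂μ with hm
  have hg : MemLp (fun y => gradient f y - m) 2 μ := hG.sub (memLp_const m)
  have hg0 : ∫ y, (gradient f y - m) ∂μ = 0 := by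
    rw [integral_sub (hG.integrable (by norm_num)) (integrable_const m), ← hm]
    simp
  have hnn : 0 ≤ ∫ y, ‖gradient f y - m‖ ^ 2 ∂μ := integral_nonneg fun y => by positivity
  set u := Real.sqrt (∫ y, ‖gradient f y - m‖ ^ 2 ∂μ)
  have hu2 : ∫ y, ‖gradient f y - m‖ ^ 2 ∂μ = u ^ 2 := (Real.sq_sqrt hnn).symm
  have hu0 : 0 ≤ u := Real.sqrt_nonneg _
  have hvu : v / u * u ≤ v := by
    rcases hu0.eq_or_lt with h | h
    · rw [← h]
      simpa using hv
    · rw [div_mul_cancel₀ _ h.ne']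
  refine ⟨fun y => (v / u) • (gradient f y - m), ?_, hg.const_smul _, ?_, ?_, ?_⟩
  · exact (((continuous_gradient hf.1).sub continuous_const).const_smul _).measurable
  · rw [integral_smul, hg0, smul_zero]
  · simp only [norm_smul, mul_pow]
    rw [integral_const_mul, hu2, ← mul_pow, Real.sqrt_sq (by positivity),
      Real.norm_of_nonneg (by positivity)]
    exact hvu
  · have e : ∀ y, ⟪gradient f y, (v / u) • (gradient f y - m)⟫
        = (v / u) * (‖gradient f y - m‖ ^ 2 + ⟪m, gradient f y - m⟫) := fun y => by
      rw [real_inner_smul_right, ← real_inner_self_eq_norm_sq, ← inner_add_left, sub_add_cancel]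
    simp only [e]
    have hsq : Integrable (fun y => ‖gradient f y - m‖ ^ 2) μ :=
      hg.integrable_norm_pow (p := 2) (by norm_num)
    have hi := hg.integrable (by norm_num)
    rw [integral_const_mul, integral_add hsq (hi.const_inner m), integral_inner hi, hg0,
      inner_zero_right, add_zero, hu2]
    rcases hu0.eq_or_lt with h | h
    · rw [← h]
      simp
    · field_simp

/-- A penalty of at least quadratic growth is bounded below by a quadratic far from zero. -/
theorem exists_penalty_bound {φ : ℝ → ℝ≥0∞}
    (hgrowth : 0 < liminf (fun v : ℝ => φ v / ENNReal.ofReal (v ^ (2 : ℝ))) atTop) :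
    ∃ c : ℝ, 0 < c ∧ ∃ R : ℝ, 0 < R ∧ ∀ v, R ≤ v → φ v ≠ ⊤ → c * v ^ 2 ≤ (φ v).toReal := by
  obtain ⟨c, hc0, hc⟩ := ENNReal.lt_iff_exists_nnreal_btwn.1 hgrowth
  obtain ⟨R, hR⟩ := eventually_atTop.1 (eventually_lt_of_lt_liminf hc)
  refine ⟨c, by exact_mod_cast hc0, max R 1, by positivity, fun v hv hφ => ?_⟩
  have h1 := (hR v ((le_max_left _ _).trans hv)).le
  have hv0 : 0 < v := lt_of_lt_of_le one_pos ((le_max_right _ _).trans hv)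
  have hv2 : 0 < v ^ (2 : ℝ) := by positivity
  rw [ENNReal.le_div_iff_mul_le (Or.inl (by simpa using hv0.ne'))
    (Or.inl ENNReal.ofReal_ne_top)] at h1
  have h2 := ENNReal.toReal_mono hφ h1
  rw [ENNReal.toReal_mul, ENNReal.toReal_ofReal hv2.le] at h2
  simpa using h2

theorem sub_toReal_le_of_phiStar_le {φ : ℝ → ℝ≥0∞} {u a : ℝ} (h : phiStar φ u ≤ a) {v : ℝ}
    (hv : 0 ≤ v) (hφ : φ v ≠ ⊤) : u * v - (φ v).toReal ≤ a := by
  have h1 : ((u * v : ℝ) : EReal) - ((φ v : ℝ≥0∞) : EReal) ≤ a :=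
    (le_iSup₂ (f := fun v (_ : v ∈ Ici (0 : ℝ)) =>
      ((u * v : ℝ) : EReal) - ((φ v : ℝ≥0∞) : EReal)) v hv).trans h
  rw [← EReal.coe_ennreal_toReal hφ, ← EReal.coe_sub] at h1
  exact_mod_cast h1

theorem eventually_perturbed_le {φ : ℝ → ℝ≥0∞} (hzero : φ 0 = 0)
    (hgrowth : 0 < liminf (fun v : ℝ => φ v / ENNReal.ofReal (v ^ (2 : ℝ))) atTop)
    {u a b : ℝ} (ha : phiStar φ u ≤ a) (hab : a < b) :
    ∃ ε : ℝ, 0 < ε ∧ ∀ K : ℝ, 0 ≤ K → ∀ᶠ h : ℝ in 𝓝[>] 0, ∀ s : ℝ, 0 ≤ s → φ s ≠ ⊤ →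
      (u + ε) * s + K * h * s ^ 2 - (φ s).toReal ≤ b := by
  obtain ⟨c, hc, R, hR, hφ⟩ := exists_penalty_bound hgrowth
  have ha0 : 0 ≤ a := by
    have := sub_toReal_le_of_phiStar_le ha le_rfl (by simp [hzero])
    simpa [hzero] using this
  have hba : 0 < b - a := sub_pos.2 hab
  set S := max R (2 * (u + 1) / c)
  have hS0 : 0 < S := lt_max_of_lt_left hR
  set ε := min 1 ((b - a) / (2 * S))
  have hε0 : 0 < ε := lt_min one_pos (by positivity)
  refine ⟨ε, hε0, fun K hK => ?_⟩
  have t1 : Tendsto (fun h : ℝ => K * h) (𝓝[>] 0) (𝓝 0) := by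
    have : Tendsto (fun h : ℝ => K * h) (𝓝 0) (𝓝 (K * 0)) := by
      exact (continuous_const.mul continuous_id).tendsto 0
    rw [mul_zero] at this
    exact this.mono_left nhdsWithin_le_nhds
  have t2 : Tendsto (fun h : ℝ => K * h * S ^ 2) (𝓝[>] 0) (𝓝 0) := by
    simpa using t1.mul_const (S ^ 2)
  filter_upwards [t1.eventually_le_const (half_pos hc), t2.eventually_le_const (half_pos hba),
    self_mem_nhdsWithin] with h h1 h2 h0 s hs hfin
  have h0 : 0 < h := h0
  rcases le_or_gt s S with hsS | hsS
  · have e1 := sub_toReal_le_of_phiStar_le ha hs hfin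
    have e2 : ε * s ≤ (b - a) / 2 := by
      have : ε * S ≤ (b - a) / (2 * S) * S :=
        mul_le_mul_of_nonneg_right (min_le_right _ _) hS0.le
      have e : (b - a) / (2 * S) * S = (b - a) / 2 := by field_simp
      exact (mul_le_mul_of_nonneg_left hsS hε0.le).trans (this.trans_eq e)
    have e3 : K * h * s ^ 2 ≤ K * h * S ^ 2 := by gcongr
    linarith
  · have e1 := hφ s ((le_max_left _ _).trans hsS.le) hfin
    have e2 : 2 * (u + 1) ≤ s * c := by
      rw [← div_le_iff₀ hc]
      exact (le_max_right _ _).trans hsS.le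
    have e3 : (u + ε) * s ≤ (u + 1) * s :=
      mul_le_mul_of_nonneg_right (by linarith [min_le_left 1 ((b - a) / (2 * S))]) hs
    have e4 : K * h * s ^ 2 ≤ c / 2 * s ^ 2 := mul_le_mul_of_nonneg_right h1 (sq_nonneg s)
    have e5 : 2 * (u + 1) * s ≤ s * c * s := mul_le_mul_of_nonneg_right e2 hs
    nlinarith

theorem scaled_IMean_le {μ : Measure X} {φ : ℝ → ℝ≥0∞} {p h b : ℝ} {f : X → ℝ} (hh : 0 < h)
    (H : ∀ ν ∈ PpMean (X := X) p μ, φ ((Wp p μ ν).toReal / h) ≠ ⊤ →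
      ∫ x, f x ∂ν - ∫ x, f x ∂μ ≤ h * (b + (φ ((Wp p μ ν).toReal / h)).toReal)) :
    ((h⁻¹ : ℝ) : EReal) * (IMean μ φ p h f - ((∫ x, f x ∂μ : ℝ) : EReal)) ≤ b := by
  have h1 : IMean μ φ p h f ≤ ((h * b : ℝ) : EReal) + ((∫ x, f x ∂μ : ℝ) : EReal) := by
    refine iSup₂_le fun ν hν => ?_
    by_cases ht : φ ((Wp p μ ν).toReal / h) = ⊤
    · rw [phih, ht, ENNReal.mul_top (by simpa using hh)]
      simp
    · have := H ν hν ht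
      rw [phih, ← EReal.coe_ennreal_toReal (ENNReal.mul_ne_top ENNReal.ofReal_ne_top ht),
        ENNReal.toReal_mul, ENNReal.toReal_ofReal hh.le, ← EReal.coe_sub, ← EReal.coe_add,
        EReal.coe_le_coe_iff]
      linarith
  have h2 := mul_le_mul_of_nonneg_left (EReal.sub_le_of_le_add h1)
    (EReal.coe_nonneg.2 (inv_pos.2 hh).le)
  rwa [← EReal.coe_mul, inv_mul_cancel_left₀ hh.ne'] at h2

theorem le_scaled_IMean {μ ν : Measure X} {φ : ℝ → ℝ≥0∞} (hmono : MonotoneOn φ (Ici (0 : ℝ)))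
    {p h v : ℝ} {f : X → ℝ} (hh : 0 < h) (hν : ν ∈ PpMean (X := X) p μ) (hv : φ v ≠ ⊤)
    (hW : (Wp p μ ν).toReal ≤ h * v) :
    ((h⁻¹ * (∫ x, f x ∂ν - ∫ x, f x ∂μ) - (φ v).toReal : ℝ) : EReal)
      ≤ ((h⁻¹ : ℝ) : EReal) * (IMean μ φ p h f - ((∫ x, f x ∂μ : ℝ) : EReal)) := by
  have hWv : (Wp p μ ν).toReal / h ≤ v := by rwa [div_le_iff₀' hh]
  have hW0 : 0 ≤ (Wp p μ ν).toReal / h := by positivity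
  have hle : φ ((Wp p μ ν).toReal / h) ≤ φ v := hmono hW0 (hW0.trans hWv) hWv
  have hfin := ne_top_of_le_ne_top hv hle
  have h1 : ((∫ x, f x ∂ν : ℝ) : EReal) - ((phih φ h (Wp p μ ν).toReal : ℝ≥0∞) : EReal)
      ≤ IMean μ φ p h f :=
    le_iSup₂ (f := fun ν (_ : ν ∈ PpMean (X := X) p μ) =>
      ((∫ x, f x ∂ν : ℝ) : EReal) - ((phih φ h (Wp p μ ν).toReal : ℝ≥0∞) : EReal)) ν hν
  rw [phih, ← EReal.coe_ennreal_toReal (ENNReal.mul_ne_top ENNReal.ofReal_ne_top hfin),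
    ENNReal.toReal_mul, ENNReal.toReal_ofReal hh.le, ← EReal.coe_sub] at h1
  have h2 := mul_le_mul_of_nonneg_left
    (EReal.sub_le_sub h1 (le_refl ((∫ x, f x ∂μ : ℝ) : EReal)))
    (EReal.coe_nonneg.2 (inv_pos.2 hh).le)
  refine le_trans ?_ h2
  rw [← EReal.coe_sub, ← EReal.coe_mul, EReal.coe_le_coe_iff]
  have h3 := ENNReal.toReal_mono hv hle
  have h4 : h⁻¹ * (∫ x, f x ∂ν - h * (φ ((Wp p μ ν).toReal / h)).toReal - ∫ x, f x ∂μ)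
      = h⁻¹ * (∫ x, f x ∂ν - ∫ x, f x ∂μ) - (φ ((Wp p μ ν).toReal / h)).toReal := by
    field_simp
    ring
  rw [h4]
  linarith

theorem stmt4 (p : ℝ) (hp : p = 2)
    (μ : Measure X) (hμ : μ ∈ Pp (X := X) p)
    (φ : ℝ → ℝ≥0∞) (hmono : MonotoneOn φ (Ici (0 : ℝ))) (hzero : φ 0 = 0)
    (hgrowth : 0 < liminf (fun v : ℝ => φ v / ENNReal.ofReal (v ^ p)) atTop)
    (f : X → ℝ) (hf : MemC1p p f) :
    Tendsto (fun h : ℝ =>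
        ((h⁻¹ : ℝ) : EReal) * (IMean μ φ p h f - ((∫ x, f x ∂μ : ℝ) : EReal)))
      (𝓝[>] (0 : ℝ))
      (𝓝 (phiStar φ
        (Real.sqrt (∫ y, ‖gradient f y - ∫ z, gradient f z ∂μ‖ ^ 2 ∂μ)))) := by
  subst hp
  set u := Real.sqrt (∫ y, ‖gradient f y - ∫ z, gradient f z ∂μ‖ ^ 2 ∂μ) with hu
  refine tendsto_order.2 ⟨fun a ha => ?_, fun a ha => ?_⟩
  · obtain ⟨v, hv⟩ := lt_iSup_iff.1 ha
    obtain ⟨hv0, hv⟩ := lt_iSup_iff.1 hv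
    have hv0 : 0 ≤ v := hv0
    have hfin : φ v ≠ ⊤ := fun ht => by simp [ht] at hv
    rw [← EReal.coe_ennreal_toReal hfin, ← EReal.coe_sub] at hv
    obtain ⟨θ, hθ, hθ2, hθ0, hθv, hθu⟩ := exists_field_of_gradient hμ hf hv0
    have hlim := (tendsto_integral_map_sub_div hμ hf hθ hθ2).sub_const (φ v).toReal
    rw [hθu] at hlim
    have hlim' := (continuous_coe_real_ereal.tendsto _).comp hlim
    filter_upwards [hlim'.eventually_const_lt hv, self_mem_nhdsWithin] with h h1 h0
    have h0 : 0 < h := h0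
    refine h1.trans_le (le_scaled_IMean hmono h0 (map_add_mem_PpMean hμ (hθ.const_smul h)
      (hθ2.const_smul h) ?_) hfin ((toReal_Wp_map_add_le hμ (hθ.const_smul h)
      (hθ2.const_smul h)).trans ?_))
    · rw [integral_smul, hθ0, smul_zero]
    · simp only [Pi.smul_apply, norm_smul, mul_pow]
      rw [integral_const_mul, Real.sqrt_mul (by positivity), Real.sqrt_sq (norm_nonneg _),
        Real.norm_of_nonneg h0.le]
      exact mul_le_mul_of_nonneg_left hθv h0.le
  · obtain ⟨b, hb, hba⟩ := EReal.lt_iff_exists_real_btwn.1 ha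
    obtain ⟨c, hc, hcb⟩ := EReal.lt_iff_exists_real_btwn.1 hb
    obtain ⟨ε, hε, hpert⟩ := eventually_perturbed_le hzero hgrowth hc.le
      (EReal.coe_lt_coe_iff.1 hcb)
    obtain ⟨K, hK, hν⟩ := exists_integral_sub_le_Wp hμ hf hε
    filter_upwards [hpert K hK, self_mem_nhdsWithin] with h h1 h0
    have h0 : 0 < h := h0
    refine (scaled_IMean_le h0 fun ν hνm hfin => ?_).trans_lt hba
    have h2 := h1 ((Wp 2 μ ν).toReal / h) (by positivity) hfin
    have h3 := hν ν hνm
    rw [← hu] at h3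
    refine h3.trans ?_
    have h4 := mul_le_mul_of_nonneg_left h2 h0.le
    have h5 : h * ((u + ε) * ((Wp 2 μ ν).toReal / h) + K * h * ((Wp 2 μ ν).toReal / h) ^ 2
        - (φ ((Wp 2 μ ν).toReal / h)).toReal)
        = (u + ε) * (Wp 2 μ ν).toReal + K * (Wp 2 μ ν).toReal ^ 2
          - h * (φ ((Wp 2 μ ν).toReal / h)).toReal := by
      field_simp
    rw [h5] at h4
    linarith
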